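/- arXiv:1311.0944 — 2 statements merged into one kernel-verified Lean document; each statement's English description precedes it below -/
import Mathlib

section
/- Let M be a matroid on a finite ground set U that is not the free matroid (i.e., 𝒞(M) ≠ ∅). Then the relation R(M) induced from M is symmetric and transitive on U. -/
open Set

/-- A circuit of a matroid `M`: a minimal dependent subset of the ground set. -/
def IsCircuit {α : Type*} (M : Matroid α) (C : Set α) : Prop :=
  M.Dep C ∧ ∀ D, D ⊂ C → M.Indep D

/-- The relation `R(M)` induced from the matroid `M`:
`x R(M) y` iff there is a circuit of `M` containing both `x` and `y`. -/
def matroidRel {α : Type*} (M : Matroid α) (x y : α) : Prop :=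
  ∃ C, IsCircuit M C ∧ x ∈ C ∧ y ∈ C

/-- The successor neighborhood `R(M)N(x) = {y | x R(M) y}`. -/
def nbhd {α : Type*} (M : Matroid α) (x : α) : Set α :=
  {y | matroidRel M x y}

/-- The upper approximation of `X` with respect to `R(M)`. -/
def upperApprox {α : Type*} (M : Matroid α) (X : Set α) : Set α :=
  {x | (nbhd M x ∩ X).Nonempty}

theorem isCircuit_iff_matroid_isCircuit {α : Type*} {M : Matroid α} {C : Set α} :
    IsCircuit M C ↔ M.IsCircuit C :=
  Matroid.isCircuit_iff_forall_ssubset.symm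

theorem Matroid.IsCircuit.exists_isCircuit_mem_mem {α : Type*} {M : Matroid α} [M.Finitary]
    {C₁ C₂ : Set α} {x z : α} (hC₁ : M.IsCircuit C₁) (hC₂ : M.IsCircuit C₂)
    (hx : x ∈ C₁) (hz : z ∈ C₂) (hne : (C₁ ∩ C₂).Nonempty) :
    ∃ C, M.IsCircuit C ∧ x ∈ C ∧ z ∈ C := by
  induction hn : (C₁ ∪ C₂).ncard using Nat.strong_induction_on generalizing C₂ with
  | _ n ih =>
    obtain ⟨e, he₁, he₂⟩ := hne
    by_cases hx₂ : x ∈ C₂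
    · exact ⟨C₂, hC₂, hx₂, hz⟩
    obtain ⟨C₃, hC₃ss, hC₃, hx₃⟩ := hC₁.strong_elimination hC₂ he₁ he₂ hx hx₂
    by_cases hz₃ : z ∈ C₃
    · exact ⟨C₃, hC₃, hx₃, hz₃⟩
    have hC₃₁ : ¬ C₃ ⊆ C₁ := fun h ↦
      (hC₃ss (hC₃.eq_of_subset_isCircuit hC₁ h ▸ he₁)).2 rfl
    obtain ⟨f, hf₃, hf₁⟩ := not_subset.1 hC₃₁
    have hf₂ : f ∈ C₂ := (hC₃ss hf₃).1.resolve_left hf₁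
    obtain ⟨C₄, hC₄ss, hC₄, hz₄⟩ := hC₂.strong_elimination hC₃ hf₂ hf₃ hz hz₃
    have hC₄₂ : ¬ C₄ ⊆ C₂ := fun h ↦
      (hC₄ss (hC₄.eq_of_subset_isCircuit hC₂ h ▸ hf₂)).2 rfl
    obtain ⟨g, hg₄, hg₂⟩ := not_subset.1 hC₄₂
    have hg₁ : g ∈ C₁ := (hC₃ss ((hC₄ss hg₄).1.resolve_left hg₂)).1.resolve_right hg₂
    have hss : C₁ ∪ C₄ ⊂ C₁ ∪ C₂ := by
      refine (ssubset_iff_of_subset (union_subset subset_union_left fun a ha ↦ ?_)).2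
        ⟨f, Or.inr hf₂, fun h ↦ h.elim hf₁ fun hf₄ ↦ (hC₄ss hf₄).2 rfl⟩
      exact (hC₄ss ha).1.elim Or.inr fun ha₃ ↦ (hC₃ss ha₃).1
    exact ih _ (hn ▸ ncard_lt_ncard hss (hC₁.finite.union hC₂.finite)) hC₄ hz₄ ⟨g, hg₁, hg₄⟩ rfl

theorem matroidRel_symm_and_trans {α : Type*} [Fintype α] (M : Matroid α)
    (hE : M.E = Set.univ) (hM : {C | IsCircuit M C}.Nonempty) :
    (∀ x y : α, matroidRel M x y → matroidRel M y x) ∧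
      (∀ x y z : α, matroidRel M x y → matroidRel M y z → matroidRel M x z) := by
  refine ⟨fun x y ⟨C, hC, hx, hy⟩ ↦ ⟨C, hC, hy, hx⟩, ?_⟩
  rintro x y z ⟨C₁, hC₁, hx, hy₁⟩ ⟨C₂, hC₂, hy₂, hz⟩
  simp only [matroidRel, isCircuit_iff_matroid_isCircuit] at *
  exact hC₁.exists_isCircuit_mem_mem hC₂ hx hz ⟨y, hy₁, hy₂⟩
end

section
/- Let M be a matroid on a finite ground set U that is not the free matroid (i.e., 𝒞(M) ≠ ∅), and suppose the union of all circuits of M equals U, i.e., ⋃𝒞(M) = U. Then the relation R(M) induced from M is an equivalence relation on U. -/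
open Set

/-- Strong circuit elimination together with a witness that the new circuit leaves `C₁`. -/
theorem Matroid.IsCircuit.exists_strong_elimination_inter_sdiff_nonempty {α : Type*}
    {M : Matroid α} {C₁ C₂ : Set α} {x y : α} (h₁ : M.IsCircuit C₁) (h₂ : M.IsCircuit C₂)
    (hx₁ : x ∈ C₁) (hx₂ : x ∉ C₂) (hy₁ : y ∈ C₁) (hy₂ : y ∈ C₂) :
    ∃ C ⊆ (C₁ ∪ C₂) \ {y}, M.IsCircuit C ∧ x ∈ C ∧ (C ∩ (C₂ \ C₁)).Nonempty := by
  obtain ⟨C, hCss, hC, hxC⟩ := h₁.strong_elimination h₂ hy₁ hy₂ hx₁ hx₂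
  refine ⟨C, hCss, hC, hxC, ?_⟩
  have hCC₁ : ¬ C ⊆ C₁ := fun h ↦
    (hCss ((hC.eq_of_subset_isCircuit h₁ h).symm ▸ hy₁ : y ∈ C)).2 rfl
  obtain ⟨w, hwC, hw₁⟩ := Set.not_subset.1 hCC₁
  exact ⟨w, hwC, (hCss hwC).1.resolve_left hw₁, hw₁⟩

/-- If two finite circuits meet, then any element of the first lies in a common circuit with
any element of the second. -/
theorem Matroid.IsCircuit.exists_isCircuit_mem_mem_of_inter_nonempty {α : Type*}
    {M : Matroid α} {C₁ C₂ : Set α} {x z : α} (h₁ : M.IsCircuit C₁) (h₂ : M.IsCircuit C₂)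
    (hfin : (C₁ ∪ C₂).Finite) (hx : x ∈ C₁) (hz : z ∈ C₂) (hne : (C₁ ∩ C₂).Nonempty) :
    ∃ C, M.IsCircuit C ∧ x ∈ C ∧ z ∈ C := by
  induction hn : (C₁ ∪ C₂).ncard using Nat.strong_induction_on generalizing C₁ C₂ with
  | _ n ih =>
  subst hn
  have of_ssubset {D₁ D₂ : Set α} (hD₁ : M.IsCircuit D₁) (hD₂ : M.IsCircuit D₂) (hxD : x ∈ D₁)
      (hzD : z ∈ D₂) (hD : (D₁ ∩ D₂).Nonempty) (hss : D₁ ∪ D₂ ⊂ C₁ ∪ C₂) :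
      ∃ C, M.IsCircuit C ∧ x ∈ C ∧ z ∈ C :=
    ih _ (Set.ncard_lt_ncard hss hfin) hD₁ hD₂ (hfin.subset hss.subset) hxD hzD hD rfl
  by_cases hx₂ : x ∈ C₂
  · exact ⟨C₂, h₂, hx₂, hz⟩
  by_cases hz₁ : z ∈ C₁
  · exact ⟨C₁, h₁, hx, hz₁⟩
  obtain ⟨y, hy₁, hy₂⟩ := hne
  obtain ⟨C₃, hC₃ss, hC₃, hxC₃, w, hwC₃, hw₂, hw₁⟩ :=
    h₁.exists_strong_elimination_inter_sdiff_nonempty h₂ hx hx₂ hy₁ hy₂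
  obtain ⟨C₄, hC₄ss, hC₄, hzC₄, v, hvC₄, hv₁, hv₂⟩ :=
    h₂.exists_strong_elimination_inter_sdiff_nonempty h₁ hz hz₁ hy₂ hy₁
  rw [Set.union_comm] at hC₄ss
  by_cases hwC₄ : w ∈ C₄
  · refine of_ssubset hC₃ hC₄ hxC₃ hzC₄ ⟨w, hwC₃, hwC₄⟩ ?_
    exact (Set.union_subset hC₃ss hC₄ss).trans_ssubset
      (Set.sdiff_singleton_ssubset.2 (Or.inl hy₁))
  · refine of_ssubset h₁ hC₄ hx hzC₄ ⟨v, hv₁, hvC₄⟩ ?_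
    refine (Set.ssubset_iff_of_subset ?_).2 ⟨w, Or.inr hw₂, fun h ↦ h.elim hw₁ hwC₄⟩
    exact Set.union_subset Set.subset_union_left (hC₄ss.trans Set.sdiff_subset)

theorem matroidRel_equivalence {α : Type*} [Fintype α] (M : Matroid α)
    (hE : M.E = Set.univ) (hM : {C | IsCircuit M C}.Nonempty)
    (hU : ⋃₀ {C | IsCircuit M C} = Set.univ) :
    Equivalence (matroidRel M) := by
  refine ⟨fun x ↦ ?_, fun ⟨C, hC, hx, hy⟩ ↦ ⟨C, hC, hy, hx⟩, ?_⟩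
  · obtain ⟨C, hC, hx⟩ := Set.mem_sUnion.1 (hU ▸ Set.mem_univ x)
    exact ⟨C, hC, hx, hx⟩
  · rintro x y z ⟨C₁, h₁, hx, hy₁⟩ ⟨C₂, h₂, hy₂, hz⟩
    rw [isCircuit_iff_matroid_isCircuit] at h₁ h₂
    obtain ⟨C, hC, hxC, hzC⟩ := h₁.exists_isCircuit_mem_mem_of_inter_nonempty h₂
      (Set.toFinite _) hx hz ⟨y, hy₁, hy₂⟩
    exact ⟨C, isCircuit_iff_matroid_isCircuit.2 hC, hxC, hzC⟩
end
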